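/- Fix n ∈ ℕ, ℓ ≥ 1, κ ∈ [0,1], ρ ≥ 0, and v ∈ ℕ, and set t1 = (1+κ)/2 + v/ℓ + ρ and t2 = (1+3κ)/2 − 15κ²/4 − 5κ/ℓ − ρ; assume t1 < t2. Sample S uniformly at random from ({0,1}^n)^ℓ (viewed as a multiset of size ℓ), and then sample U ⊆ {0,1}^n by including each y ∈ {0,1}^n independently with probability 1 − e^{−κ γ_y^{(S)}}/2. Then the probability that (S,U) fails to be a (t1,t2,v)-strong yes instance is at most ℓ⁶ 2^{−n} + 2ℓ² exp(−ρ² 2^n/(2ℓ²)). -/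

import Mathlib

open scoped BigOperators

attribute [local instance] Classical.propDecidable

/-- The group `{0,1}^n` with bitwise XOR as addition. -/
abbrev BV (n : ℕ) : Type := Fin n → ZMod 2

/-- The sign `(−1)^{x·y}` where `x·y` is the mod-2 inner product. -/
noncomputable def chiR {n : ℕ} (x y : BV n) : ℝ :=
  if (∑ j, x j * y j : ZMod 2) = 0 then 1 else -1

/-- `γ_y^{(S)} = ((1/√ℓ) ∑_i (−1)^{y·s_i})²` for the multiset `S = {s_1,…,s_ℓ}`. -/
noncomputable def gammaS {n ℓ : ℕ} (S : Fin ℓ → BV n) (y : BV n) : ℝ :=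
  ((Real.sqrt ℓ)⁻¹ * ∑ i, chiR y (S i)) ^ 2

/-- The inclusion probability `1 − e^{−κ γ_y^{(S)}}/2` of `y` in `U`. -/
noncomputable def pInc {n ℓ : ℕ} (κ : ℝ) (S : Fin ℓ → BV n) (y : BV n) : ℝ :=
  1 - Real.exp (-(κ * gammaS S y)) / 2

/-- The probability of obtaining the set `U` when each `y` is included independently
with probability `pInc κ S y`. -/
noncomputable def wgt {n ℓ : ℕ} (κ : ℝ) (S : Fin ℓ → BV n) (U : Finset (BV n)) : ℝ :=
  ∏ y : BV n, if y ∈ U then pInc κ S y else 1 - pInc κ S y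

/-- The Hadamard matrix `H^{⊗n}` with entries `2^{−n/2} (−1)^{x·y}`. -/
noncomputable def Had (n : ℕ) : Matrix (BV n) (BV n) ℝ :=
  Matrix.of fun x y => (Real.sqrt ((2 : ℝ) ^ n))⁻¹ * chiR x y

/-- The diagonal projection `Π_T = ∑_{x∈T} |x⟩⟨x|`. -/
noncomputable def projM {n : ℕ} (T : Finset (BV n)) : Matrix (BV n) (BV n) ℝ :=
  Matrix.of fun x y => if x = y ∧ x ∈ T then 1 else 0

/-- The set of distinct elements of the multiset `S`. -/
noncomputable def distinctS {n ℓ : ℕ} (S : Fin ℓ → BV n) : Finset (BV n) :=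
  Finset.image S Finset.univ

/-- `M^{S,U} = Π_S · H^{⊗n} · Π_U · H^{⊗n} · Π_S`. -/
noncomputable def MSU {n ℓ : ℕ} (S : Fin ℓ → BV n) (U : Finset (BV n)) :
    Matrix (BV n) (BV n) ℝ :=
  projM (distinctS S) * Had n * projM U * Had n * projM (distinctS S)

/-- `M^S = E_U[M^{S,U}]`, the entrywise expectation over the random set `U` given `S`. -/
noncomputable def MS {n ℓ : ℕ} (κ : ℝ) (S : Fin ℓ → BV n) : Matrix (BV n) (BV n) ℝ :=
  Matrix.of fun x x' => ∑ U : Finset (BV n), wgt κ S U * MSU S U x x'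

/-- The operator (spectral) norm of a real matrix. -/
noncomputable def opN {m : Type*} [Fintype m] [DecidableEq m] (A : Matrix m m ℝ) : ℝ :=
  ‖LinearMap.toContinuousLinearMap (Matrix.toEuclideanLin A)‖

/-- The principal submatrix of `A` with rows and columns in `Δ`. -/
noncomputable def subM {n : ℕ} (A : Matrix (BV n) (BV n) ℝ) (Δ : Finset (BV n)) :
    Matrix {x // x ∈ Δ} {x // x ∈ Δ} ℝ :=
  A.submatrix (fun a => (a : BV n)) (fun a => (a : BV n))

/-- The spectral Forrelation `‖Π_U · H^{⊗n} · Π_S‖_op²` of a pair of sets `(Sset, Uset)`. -/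
noncomputable def sfVal {n : ℕ} (Sset Uset : Finset (BV n)) : ℝ :=
  (opN (projM Uset * Had n * projM Sset)) ^ 2

/-- `(S, U)` is a `(t1, t2, v)`-strong yes instance: `(S,U)` is at least `t2`-spectrally
Forrelated, and `(Δ, U)` is at most `t1`-spectrally Forrelated for every subset `Δ` of the
distinct elements of `S` with `|Δ| ≤ v`. -/
def StrongYes {n ℓ : ℕ} (t1 t2 : ℝ) (v : ℕ) (S : Fin ℓ → BV n) (U : Finset (BV n)) : Prop :=
  t2 ≤ sfVal (distinctS S) U ∧
  ∀ Δ : Finset (BV n), ↑Δ ⊆ Set.range S → Δ.card ≤ v → sfVal Δ U ≤ t1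

lemma chiR_sq {n : ℕ} (x y : BV n) : chiR x y * chiR x y = 1 := by
  unfold chiR; split_ifs <;> norm_num

lemma sgn_add (a b : ZMod 2) : (if a + b = 0 then (1:ℝ) else -1)
    = (if a = 0 then (1:ℝ) else -1) * (if b = 0 then (1:ℝ) else -1) := by
  have h01 : ∀ c : ZMod 2, c = 0 ∨ c = 1 := by decide
  have h11 : (1 + 1 : ZMod 2) = 0 := by decide
  rcases h01 a with rfl | rfl <;> rcases h01 b with rfl | rfl <;> simp [h11]

lemma chiR_add_right {n : ℕ} (x y z : BV n) : chiR x (y + z) = chiR x y * chiR x z := by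
  unfold chiR
  rw [← sgn_add, ← Finset.sum_add_distrib]
  simp only [Pi.add_apply, mul_add]

lemma chiR_add_left {n : ℕ} (x y z : BV n) : chiR (x + y) z = chiR x z * chiR y z := by
  unfold chiR
  rw [← sgn_add, ← Finset.sum_add_distrib]
  simp only [Pi.add_apply, add_mul]

lemma chiR_zero {n : ℕ} (x : BV n) : chiR x 0 = 1 := by
  simp [chiR]

lemma chiR_sum {n : ℕ} {ι : Type*} (s : Finset ι) (x : BV n) (f : ι → BV n) :
    chiR x (∑ i ∈ s, f i) = ∏ i ∈ s, chiR x (f i) := by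
  induction s using Finset.induction_on with
  | empty => simp [chiR_zero]
  | insert a s ha ih => rw [Finset.sum_insert ha, Finset.prod_insert ha, chiR_add_right, ih]

lemma sum_chiR {n : ℕ} (z : BV n) (hz : z ≠ 0) : ∑ y : BV n, chiR y z = 0 := by
  obtain ⟨k, hk⟩ := Function.ne_iff.mp hz
  have h1 : chiR (Pi.single k 1 : BV n) z = -1 := by
    unfold chiR
    rw [if_neg]
    simpa [Pi.single_apply] using hk
  have h2 := Equiv.sum_comp (Equiv.addRight (Pi.single k 1 : BV n)) (fun y => chiR y z)
  simp only [Equiv.coe_addRight, chiR_add_left, h1] at h2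
  rw [← Finset.sum_mul] at h2
  linarith

lemma card_BV (n : ℕ) : (Fintype.card (BV n) : ℝ) = 2 ^ n := by
  simp [BV]

def GoodS {n ℓ : ℕ} (S : Fin ℓ → BV n) : Prop :=
  ∀ (j : Fin ℓ) (f : Fin 5 → Fin ℓ), (∀ a, f a ≠ j) → S j ≠ ∑ a, S (f a)

lemma good6 {n ℓ : ℕ} {S : Fin ℓ → BV n} (hS : GoodS S) (j : Fin ℓ) (f : Fin 5 → Fin ℓ)
    (hf : ∀ a, f a ≠ j) : ∑ y : BV n, (∏ a, chiR y (S (f a))) * chiR y (S j) = 0 := by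
  have := sum_chiR ((∑ a, S (f a)) + S j) (by
    intro h
    apply hS j f hf
    have h2 : S j + S j = 0 := by
      funext k
      exact CharTwo.add_self_eq_zero _
    exact (add_right_cancel (h.trans h2.symm)).symm)
  simpa only [chiR_add_right, chiR_sum] using this

lemma good4 {n ℓ : ℕ} {S : Fin ℓ → BV n} (hS : GoodS S) (j a b c : Fin ℓ)
    (ha : a ≠ j) (hb : b ≠ j) (hc : c ≠ j) :
    ∑ y : BV n, chiR y (S a) * chiR y (S b) * chiR y (S c) * chiR y (S j) = 0 := by
  rw [← good6 hS j ![a, b, c, c, c] (by intro i; fin_cases i <;> simp [ha, hb, hc])]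
  apply Finset.sum_congr rfl
  intro y _
  rw [Fin.prod_univ_five]
  change _ = chiR y (S a) * chiR y (S b) * chiR y (S c) * chiR y (S c) * chiR y (S c) * chiR y (S j)
  have := chiR_sq y (S c)
  linear_combination (-chiR y (S a) * chiR y (S b) * chiR y (S c) * chiR y (S j)) * this

lemma good2 {n ℓ : ℕ} {S : Fin ℓ → BV n} (hS : GoodS S) (j a : Fin ℓ) (ha : a ≠ j) :
    ∑ y : BV n, chiR y (S a) * chiR y (S j) = 0 := by
  rw [← good4 hS j a a a ha ha ha]
  apply Finset.sum_congr rfl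
  intro y _
  rw [chiR_sq, one_mul]

lemma good_inj {n ℓ : ℕ} {S : Fin ℓ → BV n} (hS : GoodS S) : Function.Injective S := by
  intro a j h
  by_contra hne
  have := good2 hS j a hne
  simp only [h, chiR_sq] at this
  rw [Finset.sum_const, nsmul_eq_mul, mul_one, Finset.card_univ, card_BV] at this
  exact absurd this (by positivity)

noncomputable def XA {n ℓ : ℕ} (S : Fin ℓ → BV n) (A : Finset (Fin ℓ)) (y : BV n) : ℝ :=
  ∑ i ∈ A, chiR y (S i)

lemma odd1 {n ℓ : ℕ} {S : Fin ℓ → BV n} (hS : GoodS S) (A : Finset (Fin ℓ)) (j : Fin ℓ)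
    (hj : j ∉ A) : ∑ y : BV n, XA S A y * chiR y (S j) = 0 := by
  simp only [XA, Finset.sum_mul]
  rw [Finset.sum_comm]
  refine Finset.sum_eq_zero fun i hi => good2 hS j i (fun h => hj (h ▸ hi))

lemma odd3 {n ℓ : ℕ} {S : Fin ℓ → BV n} (hS : GoodS S) (A : Finset (Fin ℓ)) (j : Fin ℓ)
    (hj : j ∉ A) : ∑ y : BV n, XA S A y ^ 3 * chiR y (S j) = 0 := by
  have key : ∀ y : BV n, XA S A y ^ 3 * chiR y (S j) =
      ∑ p ∈ Fintype.piFinset (fun _ : Fin 3 => A), (∏ a, chiR y (S (p a))) * chiR y (S j) := by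
    intro y
    rw [← Finset.sum_mul, ← Finset.prod_univ_sum (fun _ : Fin 3 => A) (fun _ i => chiR y (S i))]
    simp [XA]
  simp only [key]
  rw [Finset.sum_comm]
  refine Finset.sum_eq_zero fun p hp => ?_
  have hp' : ∀ a, p a ≠ j := fun a h => hj (h ▸ Fintype.mem_piFinset.mp hp a)
  simpa only [Fin.prod_univ_three] using good4 hS j (p 0) (p 1) (p 2) (hp' 0) (hp' 1) (hp' 2)

lemma odd5 {n ℓ : ℕ} {S : Fin ℓ → BV n} (hS : GoodS S) (A : Finset (Fin ℓ)) (j : Fin ℓ)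
    (hj : j ∉ A) : ∑ y : BV n, XA S A y ^ 5 * chiR y (S j) = 0 := by
  have key : ∀ y : BV n, XA S A y ^ 5 * chiR y (S j) =
      ∑ p ∈ Fintype.piFinset (fun _ : Fin 5 => A), (∏ a, chiR y (S (p a))) * chiR y (S j) := by
    intro y
    rw [← Finset.sum_mul, ← Finset.prod_univ_sum (fun _ : Fin 5 => A) (fun _ i => chiR y (S i))]
    simp [XA]
  simp only [key]
  rw [Finset.sum_comm]
  refine Finset.sum_eq_zero fun p hp => ?_
  have hp' : ∀ a, p a ≠ j := fun a h => hj (h ▸ Fintype.mem_piFinset.mp hp a)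
  exact good6 hS j p hp'

lemma moments {n ℓ : ℕ} {S : Fin ℓ → BV n} (hS : GoodS S) (A : Finset (Fin ℓ)) :
    (∑ y : BV n, XA S A y ^ 2 = 2 ^ n * (A.card : ℝ)) ∧
    (∑ y : BV n, XA S A y ^ 4 = 2 ^ n * (3 * (A.card : ℝ) ^ 2 - 2 * A.card)) ∧
    (∑ y : BV n, XA S A y ^ 6
      = 2 ^ n * (15 * (A.card : ℝ) ^ 3 - 30 * (A.card : ℝ) ^ 2 + 16 * A.card)) := by
  induction A using Finset.induction_on with
  | empty => simp [XA]
  | insert j A hj ih =>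
    obtain ⟨h2, h4, h6⟩ := ih
    have o1 := odd1 hS A j hj
    have o3 := odd3 hS A j hj
    have o5 := odd5 hS A j hj
    have hX : ∀ y, XA S (insert j A) y = XA S A y + chiR y (S j) := by
      intro y; simp only [XA]; rw [Finset.sum_insert hj, add_comm]
    have hone : ∑ y : BV n, (1:ℝ) = 2 ^ n := by
      rw [Finset.sum_const, nsmul_eq_mul, mul_one, Finset.card_univ, card_BV]
    have hc : ((insert j A).card : ℝ) = A.card + 1 := by
      rw [Finset.card_insert_of_notMem hj]; push_cast; ring
    refine ⟨?_, ?_, ?_⟩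
    · have e : ∀ y, XA S (insert j A) y ^ 2 = XA S A y ^ 2 + 2 * (XA S A y * chiR y (S j)) + 1 := by
        intro y; rw [hX]; linear_combination chiR_sq y (S j)
      simp only [e, Finset.sum_add_distrib, ← Finset.mul_sum, h2, o1, hone, hc]; ring
    · have e : ∀ y, XA S (insert j A) y ^ 4 = XA S A y ^ 4 + 4 * (XA S A y ^ 3 * chiR y (S j))
          + 6 * XA S A y ^ 2 + 4 * (XA S A y * chiR y (S j)) + 1 := by
        intro y; rw [hX]
        have c := chiR_sq y (S j)
        set x := XA S A y
        set d := chiR y (S j)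
        linear_combination (6 * x ^ 2 + 4 * x * d + d ^ 2 + 1) * c
      simp only [e, Finset.sum_add_distrib, ← Finset.mul_sum, h2, h4, o1, o3, hone, hc]; ring
    · have e : ∀ y, XA S (insert j A) y ^ 6 = XA S A y ^ 6 + 6 * (XA S A y ^ 5 * chiR y (S j))
          + 15 * XA S A y ^ 4 + 20 * (XA S A y ^ 3 * chiR y (S j)) + 15 * XA S A y ^ 2
          + 6 * (XA S A y * chiR y (S j)) + 1 := by
        intro y; rw [hX]
        have c := chiR_sq y (S j)
        set x := XA S A y
        set d := chiR y (S j)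
        linear_combination (15 * x ^ 4 + 20 * x ^ 3 * d + 15 * x ^ 2 * (d ^ 2 + 1)
          + 6 * x * d * (d ^ 2 + 1) + d ^ 4 + d ^ 2 + 1) * c
      simp only [e, Finset.sum_add_distrib, ← Finset.mul_sum, h2, h4, h6, o1, o3, o5, hone, hc]
      ring

lemma X2chi {n ℓ : ℕ} {S : Fin ℓ → BV n} (hS : GoodS S) (i j : Fin ℓ) (hij : i ≠ j) :
    ∑ y : BV n, XA S Finset.univ y ^ 2 * (chiR y (S i) * chiR y (S j)) = 2 ^ n * 2 := by
  set A : Finset (Fin ℓ) := (Finset.univ.erase j).erase i with hA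
  have hone : ∑ y : BV n, (1:ℝ) = 2 ^ n := by
    rw [Finset.sum_const, nsmul_eq_mul, mul_one, Finset.card_univ, card_BV]
  have hX : ∀ y, XA S Finset.univ y = XA S A y + chiR y (S i) + chiR y (S j) := by
    intro y
    simp only [XA]
    rw [← Finset.sum_erase_add _ _ (Finset.mem_univ j),
      ← Finset.sum_erase_add _ _ (Finset.mem_erase.mpr ⟨hij, Finset.mem_univ i⟩)]
  have hiA : i ∉ A := by simp [hA]
  have hjA : j ∉ A := by simp [hA]
  have o1 := odd1 hS A i hiA
  have o2 := odd1 hS A j hjA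
  have o3 := good2 hS j i hij
  have o4 : ∑ y : BV n, XA S A y ^ 2 * (chiR y (S i) * chiR y (S j)) = 0 := by
    have key : ∀ y : BV n, XA S A y ^ 2 * (chiR y (S i) * chiR y (S j)) =
        ∑ a ∈ A, ∑ b ∈ A, chiR y (S a) * chiR y (S b) * chiR y (S i) * chiR y (S j) := by
      intro y
      rw [sq]; simp only [XA]; rw [Finset.sum_mul_sum, Finset.sum_mul]
      refine Finset.sum_congr rfl fun a _ => ?_
      rw [Finset.sum_mul]
      refine Finset.sum_congr rfl fun b _ => ?_
      ring
    simp only [key]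
    rw [Finset.sum_comm]
    refine Finset.sum_eq_zero fun a ha => ?_
    rw [Finset.sum_comm]
    refine Finset.sum_eq_zero fun b hb => ?_
    exact good4 hS j a b i (fun h => hjA (h ▸ ha)) (fun h => hjA (h ▸ hb)) hij
  have e : ∀ y, XA S Finset.univ y ^ 2 * (chiR y (S i) * chiR y (S j)) =
      XA S A y ^ 2 * (chiR y (S i) * chiR y (S j)) + 2 * (chiR y (S i) * chiR y (S j))
      + 2 * (XA S A y * chiR y (S j)) + 2 * (XA S A y * chiR y (S i)) + 2 * 1 := by
    intro y
    rw [hX]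
    have c := chiR_sq y (S i)
    have d := chiR_sq y (S j)
    set x := XA S A y
    set p := chiR y (S i)
    set q := chiR y (S j)
    linear_combination (p * q + 2 * x * q + 2 * q ^ 2) * c + (p * q + 2 * x * p + 2) * d
  simp only [e, Finset.sum_add_distrib, ← Finset.mul_sum, o1, o2, o3, o4, hone]; ring

noncomputable def gf {n ℓ : ℕ} (S : Fin ℓ → BV n) (f : Fin ℓ → ℝ) (y : BV n) : ℝ :=
  ∑ i, f i * chiR y (S i)

lemma gf_sq {n ℓ : ℕ} (S : Fin ℓ → BV n) (f : Fin ℓ → ℝ) (y : BV n) :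
    gf S f y ^ 2 = ∑ i, ∑ j, f i * f j * (chiR y (S i) * chiR y (S j)) := by
  rw [sq, gf, Finset.sum_mul_sum]
  refine Finset.sum_congr rfl fun a _ => Finset.sum_congr rfl fun b _ => ?_
  ring

lemma sum_w_gf_sq {n ℓ : ℕ} (S : Fin ℓ → BV n) (f : Fin ℓ → ℝ) (w : BV n → ℝ) :
    ∑ y, w y * gf S f y ^ 2
      = ∑ i, ∑ j, f i * f j * ∑ y, w y * (chiR y (S i) * chiR y (S j)) := by
  simp only [gf_sq, Finset.mul_sum]
  rw [Finset.sum_comm]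
  refine Finset.sum_congr rfl fun i _ => ?_
  rw [Finset.sum_comm]
  refine Finset.sum_congr rfl fun j _ => Finset.sum_congr rfl fun y _ => ?_
  ring

lemma gf_norm {n ℓ : ℕ} {S : Fin ℓ → BV n} (hS : GoodS S) (f : Fin ℓ → ℝ) :
    ∑ y, gf S f y ^ 2 = 2 ^ n * ∑ i, f i ^ 2 := by
  have h := sum_w_gf_sq S f (fun _ => 1)
  simp only [one_mul] at h
  rw [h, Finset.mul_sum]
  refine Finset.sum_congr rfl fun i _ => ?_
  rw [Finset.sum_eq_single i]
  · simp only [chiR_sq]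
    rw [Finset.sum_const, nsmul_eq_mul, mul_one, Finset.card_univ, card_BV]; ring
  · intro j _ hj
    rw [good2 hS j i hj.symm, mul_zero]
  · simp

lemma X2_gf {n ℓ : ℕ} {S : Fin ℓ → BV n} (hS : GoodS S) (f : Fin ℓ → ℝ) :
    ∑ y, XA S Finset.univ y ^ 2 * gf S f y ^ 2
      = 2 ^ n * (ℓ * (∑ i, f i ^ 2) + 2 * ((∑ i, f i) ^ 2 - ∑ i, f i ^ 2)) := by
  rw [sum_w_gf_sq S f (fun y => XA S Finset.univ y ^ 2)]
  have hm := (moments hS Finset.univ).1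
  simp only [Finset.card_univ, Fintype.card_fin] at hm
  have key : ∀ i j : Fin ℓ, f i * f j * ∑ y, XA S Finset.univ y ^ 2 * (chiR y (S i) * chiR y (S j))
      = 2 ^ n * 2 * (f i * f j) + (if i = j then 2 ^ n * (ℓ - 2) * f i ^ 2 else 0) := by
    intro i j
    split_ifs with h
    · subst h
      simp only [chiR_sq, mul_one, hm]; ring
    · rw [X2chi hS i j h]; ring
  simp only [key, Finset.sum_add_distrib, ← Finset.mul_sum, ← Finset.sum_mul]
  simp only [Finset.sum_ite_eq, Finset.mem_univ, if_true, ← Finset.mul_sum]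
  ring

lemma gammaS_eq {n ℓ : ℕ} (S : Fin ℓ → BV n) (y : BV n) :
    gammaS S y = XA S Finset.univ y ^ 2 / ℓ := by
  unfold gammaS XA
  rw [mul_pow, inv_pow, Real.sq_sqrt (Nat.cast_nonneg _)]
  field_simp

lemma gammaS_nonneg {n ℓ : ℕ} (S : Fin ℓ → BV n) (y : BV n) : 0 ≤ gammaS S y := sq_nonneg _

lemma exp_neg_le (x : ℝ) (hx : 0 ≤ x) : Real.exp (-x) ≤ 1 - x + x ^ 2 / 2 := by
  have h := Real.quadratic_le_exp_of_nonneg hx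
  rw [Real.exp_neg]
  have hp : 0 < 1 + x + x ^ 2 / 2 := by positivity
  calc (Real.exp x)⁻¹ ≤ (1 + x + x ^ 2 / 2)⁻¹ := inv_anti₀ hp h
    _ ≤ 1 - x + x ^ 2 / 2 := by
      rw [inv_le_iff_one_le_mul₀ hp]
      nlinarith [sq_nonneg (x ^ 2)]

lemma pInc_le {n ℓ : ℕ} (κ : ℝ) (S : Fin ℓ → BV n) (y : BV n) :
    pInc κ S y ≤ 1 / 2 + κ * gammaS S y / 2 := by
  unfold pInc
  have := Real.add_one_le_exp (-(κ * gammaS S y))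
  linarith

lemma le_pInc {n ℓ : ℕ} (κ : ℝ) (hκ : 0 ≤ κ) (S : Fin ℓ → BV n) (y : BV n) :
    1 / 2 + κ * gammaS S y / 2 - κ ^ 2 * gammaS S y ^ 2 / 4 ≤ pInc κ S y := by
  unfold pInc
  have := exp_neg_le (κ * gammaS S y) (mul_nonneg hκ (gammaS_nonneg S y))
  nlinarith

lemma pInc_mem {n ℓ : ℕ} (κ : ℝ) (hκ : 0 ≤ κ) (S : Fin ℓ → BV n) (y : BV n) :
    0 ≤ pInc κ S y ∧ pInc κ S y ≤ 1 := by
  unfold pInc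
  have h1 : Real.exp (-(κ * gammaS S y)) ≤ 1 :=
    Real.exp_le_one_iff.mpr (neg_nonpos.mpr (mul_nonneg hκ (gammaS_nonneg S y)))
  have h2 := Real.exp_pos (-(κ * gammaS S y))
  constructor <;> linarith

/-- lower bound for the mean -/
lemma mean_lower {n ℓ : ℕ} (hℓ : 1 ≤ ℓ) (κ : ℝ) (hκ : 0 ≤ κ) {S : Fin ℓ → BV n} (hS : GoodS S) :
    2 ^ n * ℓ * ((1 + 3 * κ) / 2 - 15 * κ ^ 2 / 4 - 5 * κ / (ℓ : ℝ))
      ≤ ∑ y, pInc κ S y * XA S Finset.univ y ^ 2 := by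
  have hl : (1:ℝ) ≤ ℓ := by exact_mod_cast hℓ
  have hl0 : (0:ℝ) < ℓ := by linarith
  obtain ⟨h2, h4, h6⟩ := moments hS Finset.univ
  simp only [Finset.card_univ, Fintype.card_fin] at h2 h4 h6
  have hN : (0:ℝ) < 2 ^ n := by positivity
  calc _ ≤ 1 / 2 * (2 ^ n * (ℓ:ℝ)) + κ / (2 * ℓ) * (2 ^ n * (3 * (ℓ : ℝ) ^ 2 - 2 * ℓ))
        - κ ^ 2 / (4 * ℓ ^ 2) * (2 ^ n * (15 * (ℓ : ℝ) ^ 3 - 30 * (ℓ : ℝ) ^ 2 + 16 * ℓ)) := by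
        have : 1 / 2 * (2 ^ n * (ℓ:ℝ)) + κ / (2 * ℓ) * (2 ^ n * (3 * (ℓ : ℝ) ^ 2 - 2 * ℓ))
            - κ ^ 2 / (4 * ℓ ^ 2) * (2 ^ n * (15 * (ℓ : ℝ) ^ 3 - 30 * (ℓ : ℝ) ^ 2 + 16 * ℓ))
            - 2 ^ n * ℓ * ((1 + 3 * κ) / 2 - 15 * κ ^ 2 / 4 - 5 * κ / (ℓ : ℝ))
            = 2 ^ n * (4 * κ + κ ^ 2 * (30 * ℓ - 16) / (4 * ℓ)) := by
          field_simp; ring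
        have h : 0 ≤ 2 ^ n * (4 * κ + κ ^ 2 * (30 * ℓ - 16) / (4 * ℓ)) := by
          have : (0:ℝ) ≤ 30 * ℓ - 16 := by linarith
          positivity
        linarith
    _ = ∑ y, (1 / 2 + κ * gammaS S y / 2 - κ ^ 2 * gammaS S y ^ 2 / 4) * XA S Finset.univ y ^ 2 := by
        rw [← h2, ← h4, ← h6, Finset.mul_sum, Finset.mul_sum, Finset.mul_sum,
          ← Finset.sum_add_distrib, ← Finset.sum_sub_distrib]
        refine Finset.sum_congr rfl fun y _ => ?_
        rw [gammaS_eq]; field_simp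
    _ ≤ _ := Finset.sum_le_sum fun y _ =>
        mul_le_mul_of_nonneg_right (le_pInc κ hκ S y) (sq_nonneg _)

lemma mean_upper {n ℓ : ℕ} (hℓ : 1 ≤ ℓ) (κ : ℝ) (hκ : 0 ≤ κ) (hκ1 : κ ≤ 1)
    {S : Fin ℓ → BV n} (hS : GoodS S) (f : Fin ℓ → ℝ) (v : ℕ)
    (hf : (∑ i, f i) ^ 2 ≤ v * ∑ i, f i ^ 2) :
    ∑ y, pInc κ S y * gf S f y ^ 2 ≤ 2 ^ n * ((1 + κ) / 2 + v / (ℓ : ℝ)) * ∑ i, f i ^ 2 := by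
  have hl : (1:ℝ) ≤ ℓ := by exact_mod_cast hℓ
  have hl0 : (0:ℝ) < ℓ := by linarith
  have hN : (0:ℝ) < 2 ^ n := by positivity
  have hq : 0 ≤ ∑ i, f i ^ 2 := Finset.sum_nonneg fun i _ => sq_nonneg _
  calc _ ≤ ∑ y, (1 / 2 + κ * gammaS S y / 2) * gf S f y ^ 2 :=
        Finset.sum_le_sum fun y _ => mul_le_mul_of_nonneg_right (pInc_le κ S y) (sq_nonneg _)
    _ = 1 / 2 * (∑ y, gf S f y ^ 2) + κ / (2 * ℓ) * ∑ y, XA S Finset.univ y ^ 2 * gf S f y ^ 2 := by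
        rw [Finset.mul_sum, Finset.mul_sum, ← Finset.sum_add_distrib]
        refine Finset.sum_congr rfl fun y _ => ?_
        rw [gammaS_eq]; field_simp
    _ ≤ _ := by
        rw [gf_norm hS, X2_gf hS]
        set Q := ∑ i, f i ^ 2
        have h1 : κ / (2 * ℓ) * (2 ^ n * (ℓ * Q + 2 * ((∑ i, f i) ^ 2 - Q)))
            ≤ κ / (2 * ℓ) * (2 ^ n * (ℓ * Q + 2 * (v * Q))) := by
          gcongr
          linarith
        have h2 : κ / (2 * ℓ) * (2 ^ n * (ℓ * Q + 2 * (v * Q)))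
            = 2 ^ n * (κ / 2) * Q + κ * (2 ^ n * (v / ℓ) * Q) := by
          field_simp
        have h3 : κ * (2 ^ n * (v / ℓ) * Q) ≤ 1 * (2 ^ n * (v / ℓ) * Q) :=
          mul_le_mul_of_nonneg_right hκ1 (by positivity)
        linarith

/-- centred indicator -/
noncomputable def dev {n ℓ : ℕ} (κ : ℝ) (S : Fin ℓ → BV n) (U : Finset (BV n)) (y : BV n) : ℝ :=
  (if y ∈ U then 1 else 0) - pInc κ S y

def Conc {n ℓ : ℕ} (κ ρ : ℝ) (S : Fin ℓ → BV n) (U : Finset (BV n)) : Prop :=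
  ∀ i j : Fin ℓ, |∑ y, dev κ S U y * (chiR y (S i) * chiR y (S j))| ≤ 2 ^ n * ρ / ℓ

lemma conc_gf {n ℓ : ℕ} (hℓ : 1 ≤ ℓ) {κ ρ : ℝ} (hρ : 0 ≤ ρ) {S : Fin ℓ → BV n}
    {U : Finset (BV n)} (hc : Conc κ ρ S U) (f : Fin ℓ → ℝ) :
    |∑ y ∈ U, gf S f y ^ 2 - ∑ y, pInc κ S y * gf S f y ^ 2| ≤ 2 ^ n * ρ * ∑ i, f i ^ 2 := by
  have hl0 : (0:ℝ) < ℓ := by exact_mod_cast hℓ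
  have h1 : ∑ y ∈ U, gf S f y ^ 2 - ∑ y, pInc κ S y * gf S f y ^ 2
      = ∑ y, dev κ S U y * gf S f y ^ 2 := by
    simp only [dev, sub_mul, Finset.sum_sub_distrib, ite_mul, one_mul, zero_mul]
    congr 1
    simp
  rw [h1, sum_w_gf_sq]
  calc _ ≤ ∑ i, ∑ j, |f i| * |f j| * (2 ^ n * ρ / ℓ) := by
        refine (Finset.abs_sum_le_sum_abs _ _).trans (Finset.sum_le_sum fun i _ => ?_)
        refine (Finset.abs_sum_le_sum_abs _ _).trans (Finset.sum_le_sum fun j _ => ?_)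
        rw [abs_mul, abs_mul]
        exact mul_le_mul_of_nonneg_left (hc i j) (by positivity)
    _ = (∑ i, |f i|) ^ 2 * (2 ^ n * ρ / ℓ) := by
        rw [sq, Finset.sum_mul_sum, Finset.sum_mul]
        refine Finset.sum_congr rfl fun i _ => ?_
        rw [Finset.sum_mul]
    _ ≤ (ℓ * ∑ i, f i ^ 2) * (2 ^ n * ρ / ℓ) := by
        refine mul_le_mul_of_nonneg_right ?_ (by positivity)
        have := sq_sum_le_card_mul_sum_sq (s := (Finset.univ : Finset (Fin ℓ))) (f := fun i => |f i|)
        simpa using this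
    _ = _ := by field_simp

lemma mat_apply {n : ℕ} (T U : Finset (BV n)) (w : BV n → ℝ) (y : BV n) :
    ((projM U * Had n * projM T).mulVec w) y
      = if y ∈ U then (Real.sqrt ((2 : ℝ) ^ n))⁻¹ * ∑ x ∈ T, w x * chiR y x else 0 := by
  rw [← Matrix.mulVec_mulVec, ← Matrix.mulVec_mulVec]
  have hp : ∀ (T : Finset (BV n)) (w : BV n → ℝ) (x : BV n),
      (projM T).mulVec w x = if x ∈ T then w x else 0 := by
    intro T w x
    simp only [Matrix.mulVec, dotProduct, projM, Matrix.of_apply]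
    rw [Finset.sum_eq_single x]
    · by_cases h : x ∈ T <;> simp [h]
    · intro b _ hb
      rw [if_neg (fun h => hb h.1.symm), zero_mul]
    · simp
  rw [hp]
  split_ifs
  · simp only [Matrix.mulVec, dotProduct, Had, Matrix.of_apply]
    have hp' := hp T w
    simp only [Matrix.mulVec, dotProduct] at hp'
    simp only [hp', mul_ite, mul_zero]
    rw [Finset.mul_sum, Finset.sum_ite_mem, Finset.univ_inter]
    refine Finset.sum_congr rfl fun x _ => ?_
    ring
  · rfl

lemma norm_mat {n : ℕ} (T U : Finset (BV n)) (w : EuclideanSpace ℝ (BV n)) :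
    ‖LinearMap.toContinuousLinearMap (Matrix.toEuclideanLin (projM U * Had n * projM T)) w‖ ^ 2
      = (2 ^ n)⁻¹ * ∑ y ∈ U, (∑ x ∈ T, w x * chiR y x) ^ 2 := by
  rw [EuclideanSpace.norm_sq_eq]
  have h : ∀ y, (LinearMap.toContinuousLinearMap
      (Matrix.toEuclideanLin (projM U * Had n * projM T)) w) y
      = ((projM U * Had n * projM T).mulVec w) y := by
    intro y
    rfl
  simp only [h, mat_apply]
  rw [Finset.mul_sum, ← Finset.univ_inter U, ← Finset.sum_ite_mem, Finset.univ_inter]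
  refine Finset.sum_congr rfl fun y _ => ?_
  split_ifs
  · rw [Real.norm_eq_abs, sq_abs, mul_pow, inv_pow, Real.sq_sqrt (by positivity)]
  · simp

lemma opN_nonneg {n : ℕ} (A : Matrix (BV n) (BV n) ℝ) : 0 ≤ opN A := norm_nonneg _

lemma sum_image_S {n ℓ : ℕ} {S : Fin ℓ → BV n} (hinj : Function.Injective S)
    (Δ : Finset (BV n)) (hΔ : ↑Δ ⊆ Set.range S) (g : BV n → ℝ) :
    ∑ x ∈ Δ, g x = ∑ i, if S i ∈ Δ then g (S i) else 0 := by
  rw [← Finset.sum_filter]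
  symm
  apply Finset.sum_bij (fun i _ => S i)
  · intro a ha; exact (Finset.mem_filter.mp ha).2
  · intro a _ b _ h; exact hinj h
  · intro b hb
    obtain ⟨i, rfl⟩ := hΔ hb
    exact ⟨i, Finset.mem_filter.mpr ⟨Finset.mem_univ _, hb⟩, rfl⟩
  · intro a _; rfl

lemma good_conc_strong {n ℓ : ℕ} (hℓ : 1 ≤ ℓ) (κ ρ : ℝ)
    (hκ0 : 0 ≤ κ) (hκ1 : κ ≤ 1) (hρ : 0 ≤ ρ) (v : ℕ) {S : Fin ℓ → BV n}
    {U : Finset (BV n)} (hS : GoodS S) (hc : Conc κ ρ S U) :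
    StrongYes ((1 + κ) / 2 + (v : ℝ) / (ℓ : ℝ) + ρ)
      ((1 + 3 * κ) / 2 - 15 * κ ^ 2 / 4 - 5 * κ / (ℓ : ℝ) - ρ) v S U := by
  have hinj := good_inj hS
  have hl0 : (0:ℝ) < ℓ := by exact_mod_cast hℓ
  have hN : (0:ℝ) < 2 ^ n := by positivity
  constructor
  · -- lower
    set w : EuclideanSpace ℝ (BV n) :=
      WithLp.toLp 2 (fun x => if x ∈ distinctS S then 1 else 0) with hw
    have hwx : ∀ x, w x = if x ∈ distinctS S then 1 else 0 := fun x => rfl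
    have hsub : (↑(distinctS S) : Set (BV n)) ⊆ Set.range S := by
      intro x hx; simpa [distinctS] using hx
    have hmem : ∀ i, S i ∈ distinctS S := fun i => by simp [distinctS]
    have hwn : ‖w‖ ^ 2 = ℓ := by
      rw [EuclideanSpace.norm_sq_eq]
      have : ∀ x, ‖w x‖ ^ 2 = if x ∈ distinctS S then (1:ℝ) else 0 := by
        intro x; rw [hwx]; split_ifs <;> simp
      simp only [this]
      rw [Finset.sum_ite_mem, Finset.univ_inter, sum_image_S hinj _ hsub]
      simp [hmem]
    have h1 := norm_mat (distinctS S) U w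
    have h2 : ∀ y, ∑ x ∈ distinctS S, w x * chiR y x = gf S (fun _ => 1) y := by
      intro y
      rw [sum_image_S hinj _ hsub]
      simp only [hmem, if_true, hwx, gf]
    have h3 : ∀ y, gf S (fun _ => 1) y = XA S Finset.univ y := by
      intro y; simp [gf, XA]
    have h4 := (abs_le.mp (conc_gf hℓ hρ hc (fun _ => 1))).1
    simp only [h2] at h1
    simp only [h3] at h1 h4
    have h5 := mean_lower hℓ κ hκ0 hS
    have h6 := ContinuousLinearMap.le_opNorm (LinearMap.toContinuousLinearMap
      (Matrix.toEuclideanLin (projM U * Had n * projM (distinctS S)))) w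
    have h7 := pow_le_pow_left₀ (norm_nonneg _) h6 2
    rw [mul_pow, hwn, h1] at h7
    change _ ≤ sfVal (distinctS S) U * ℓ at h7
    simp at h4
    have h8 : 2 ^ n * ℓ * ((1 + 3 * κ) / 2 - 15 * κ ^ 2 / 4 - 5 * κ / (ℓ : ℝ) - ρ)
        ≤ 2 ^ n * ℓ * sfVal (distinctS S) U := by
      rw [inv_mul_le_iff₀ hN] at h7
      linarith
    exact le_of_mul_le_mul_left h8 (by positivity)
  · intro Δ hΔ hcard
    set t := (1 + κ) / 2 + (v : ℝ) / (ℓ : ℝ) + ρ with ht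
    have ht0 : 0 ≤ t := by positivity
    have hle : opN (projM U * Had n * projM Δ) ≤ Real.sqrt t := by
      refine ContinuousLinearMap.opNorm_le_bound _ (Real.sqrt_nonneg _) fun w => ?_
      refine le_of_sq_le_sq ?_ (by positivity)
      rw [mul_pow, Real.sq_sqrt ht0, norm_mat]
      set f : Fin ℓ → ℝ := fun i => if S i ∈ Δ then w (S i) else 0 with hf
      have h2 : ∀ y, ∑ x ∈ Δ, w x * chiR y x = gf S f y := by
        intro y
        rw [sum_image_S hinj _ hΔ]
        simp only [gf, hf, ite_mul, zero_mul]
      simp only [h2]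
      have hfs : ∑ i, f i ^ 2 = ∑ x ∈ Δ, w x ^ 2 := by
        rw [sum_image_S hinj _ hΔ]
        refine Finset.sum_congr rfl fun i _ => ?_
        simp only [hf]; split_ifs <;> simp
      have hfs1 : ∑ i, f i = ∑ x ∈ Δ, w x := by
        rw [sum_image_S hinj _ hΔ]
      have hq : (∑ i, f i) ^ 2 ≤ v * ∑ i, f i ^ 2 := by
        rw [hfs, hfs1]
        refine sq_sum_le_card_mul_sum_sq.trans ?_
        refine mul_le_mul_of_nonneg_right (by exact_mod_cast hcard) ?_
        exact Finset.sum_nonneg fun i _ => sq_nonneg _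
      have hwn : ∑ i, f i ^ 2 ≤ ‖w‖ ^ 2 := by
        rw [hfs, EuclideanSpace.norm_sq_eq]
        simp only [Real.norm_eq_abs, sq_abs]
        exact Finset.sum_le_sum_of_subset_of_nonneg (Finset.subset_univ _)
          fun i _ _ => sq_nonneg _
      have h4 := (abs_le.mp (conc_gf hℓ hρ hc f)).2
      have h5 := mean_upper hℓ κ hκ0 hκ1 hS f v hq
      rw [inv_mul_le_iff₀ hN]
      have h6 : t * ∑ i, f i ^ 2 ≤ t * ‖w‖ ^ 2 := mul_le_mul_of_nonneg_left hwn ht0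
      have h7 : 2 ^ n * (t * ∑ i, f i ^ 2) ≤ 2 ^ n * (t * ‖w‖ ^ 2) :=
        mul_le_mul_of_nonneg_left h6 hN.le
      rw [ht] at h7 ⊢
      linarith
    calc sfVal Δ U ≤ Real.sqrt t ^ 2 := pow_le_pow_left₀ (opN_nonneg _) hle 2
      _ = t := Real.sq_sqrt ht0

lemma sum_prod_U {n : ℕ} (a b : BV n → ℝ) :
    ∑ U : Finset (BV n), ∏ y, (if y ∈ U then a y else b y) = ∏ y, (a y + b y) := by
  rw [Finset.prod_add, Finset.powerset_univ]
  refine Finset.sum_congr rfl fun U _ => ?_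
  rw [Finset.prod_ite]
  congr 1
  · exact Finset.prod_congr (by ext; simp) fun _ _ => rfl
  · exact Finset.prod_congr (by ext; simp) fun _ _ => rfl

lemma wgt_nonneg {n ℓ : ℕ} {κ : ℝ} (hκ : 0 ≤ κ) (S : Fin ℓ → BV n) (U : Finset (BV n)) :
    0 ≤ wgt κ S U := by
  refine Finset.prod_nonneg fun y _ => ?_
  have := pInc_mem κ hκ S y
  split_ifs <;> linarith

lemma wgt_sum {n ℓ : ℕ} (κ : ℝ) (S : Fin ℓ → BV n) : ∑ U, wgt κ S U = 1 := by
  unfold wgt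
  rw [sum_prod_U]
  simp

lemma exp_le_cosh_sinh (l x : ℝ) (h1 : -1 ≤ x) (h2 : x ≤ 1) :
    Real.exp (l * x) ≤ Real.cosh l + x * Real.sinh l := by
  have h := convexOn_exp.2 (Set.mem_univ l) (Set.mem_univ (-l))
    (show 0 ≤ (1 + x) / 2 by linarith) (show 0 ≤ (1 - x) / 2 by linarith) (by ring)
  simp only [smul_eq_mul] at h
  rw [Real.cosh_eq, Real.sinh_eq]
  calc _ = Real.exp ((1 + x) / 2 * l + (1 - x) / 2 * -l) := by congr 1; ring
    _ ≤ _ := h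
    _ = _ := by ring

lemma two_point (p c l : ℝ) (hp0 : 0 ≤ p) (hp1 : p ≤ 1) (hc : c = 1 ∨ c = -1) :
    p * Real.exp (l * ((1 - p) * c)) + (1 - p) * Real.exp (l * ((0 - p) * c))
      ≤ Real.exp (l ^ 2 / 2) := by
  have h1 := exp_le_cosh_sinh l ((1 - p) * c) (by rcases hc with rfl | rfl <;> linarith)
    (by rcases hc with rfl | rfl <;> linarith)
  have h2 := exp_le_cosh_sinh l ((0 - p) * c) (by rcases hc with rfl | rfl <;> linarith)
    (by rcases hc with rfl | rfl <;> linarith)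
  have h3 := Real.cosh_le_exp_half_sq l
  have h4 := mul_le_mul_of_nonneg_left h1 hp0
  have h5 := mul_le_mul_of_nonneg_left h2 (show 0 ≤ 1 - p by linarith)
  calc _ ≤ _ := add_le_add h4 h5
    _ = Real.cosh l := by ring
    _ ≤ _ := h3

lemma mgf {n ℓ : ℕ} {κ : ℝ} (hκ : 0 ≤ κ) (S : Fin ℓ → BV n) (c : BV n → ℝ)
    (hc : ∀ y, c y = 1 ∨ c y = -1) (l : ℝ) :
    ∑ U, wgt κ S U * Real.exp (l * ∑ y, dev κ S U y * c y) ≤ Real.exp (2 ^ n * (l ^ 2 / 2)) := by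
  have h : ∀ U, wgt κ S U * Real.exp (l * ∑ y, dev κ S U y * c y)
      = ∏ y, (if y ∈ U then pInc κ S y * Real.exp (l * ((1 - pInc κ S y) * c y))
        else (1 - pInc κ S y) * Real.exp (l * ((0 - pInc κ S y) * c y))) := by
    intro U
    rw [Finset.mul_sum, Real.exp_sum, wgt, ← Finset.prod_mul_distrib]
    refine Finset.prod_congr rfl fun y _ => ?_
    unfold dev
    split_ifs <;> rfl
  simp only [h]
  rw [sum_prod_U, ← card_BV, Real.exp_nat_mul, ← Finset.card_univ, ← Finset.prod_const]
  refine Finset.prod_le_prod (fun y _ => ?_) fun y _ => ?_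
  · have := pInc_mem κ hκ S y
    have : 0 ≤ 1 - pInc κ S y := by linarith
    have := (pInc_mem κ hκ S y).1
    positivity
  · exact two_point _ _ _ (pInc_mem κ hκ S y).1 (pInc_mem κ hκ S y).2 (hc y)

lemma chernoff {n ℓ : ℕ} (hℓ : 1 ≤ ℓ) {κ ρ : ℝ} (hκ : 0 ≤ κ) (hρ : 0 ≤ ρ) (S : Fin ℓ → BV n)
    (c : BV n → ℝ) (hc : ∀ y, c y = 1 ∨ c y = -1) :
    ∑ U, (if 2 ^ n * ρ / ℓ < ∑ y, dev κ S U y * c y then wgt κ S U else 0)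
      ≤ Real.exp (-(ρ ^ 2 * 2 ^ n / (2 * (ℓ : ℝ) ^ 2))) := by
  have hl0 : (0:ℝ) < ℓ := by exact_mod_cast hℓ
  set l := ρ / ℓ with hl
  have hlp : 0 ≤ l := by positivity
  calc _ ≤ ∑ U, Real.exp (-(l * (2 ^ n * ρ / ℓ)))
        * (wgt κ S U * Real.exp (l * ∑ y, dev κ S U y * c y)) := by
        refine Finset.sum_le_sum fun U _ => ?_
        have hw := wgt_nonneg hκ S U
        split_ifs with h
        · rw [mul_left_comm, ← Real.exp_add]
          refine le_mul_of_one_le_right hw (Real.one_le_exp ?_)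
          have := mul_le_mul_of_nonneg_left h.le hlp
          linarith
        · positivity
    _ = Real.exp (-(l * (2 ^ n * ρ / ℓ)))
        * ∑ U, (wgt κ S U * Real.exp (l * ∑ y, dev κ S U y * c y)) := by rw [Finset.mul_sum]
    _ ≤ Real.exp (-(l * (2 ^ n * ρ / ℓ))) * Real.exp (2 ^ n * (l ^ 2 / 2)) :=
        mul_le_mul_of_nonneg_left (mgf hκ S c hc l) (Real.exp_pos _).le
    _ = _ := by
        rw [← Real.exp_add]
        congr 1
        rw [hl]; field_simp; ring

lemma chiR_pm {n : ℕ} (x y : BV n) : chiR x y = 1 ∨ chiR x y = -1 := by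
  unfold chiR; split_ifs <;> simp

lemma conc_fail {n ℓ : ℕ} (hℓ : 1 ≤ ℓ) {κ ρ : ℝ} (hκ : 0 ≤ κ) (hρ : 0 ≤ ρ) (S : Fin ℓ → BV n) :
    ∑ U, (if ¬ Conc κ ρ S U then wgt κ S U else 0)
      ≤ 2 * (ℓ : ℝ) ^ 2 * Real.exp (-(ρ ^ 2 * 2 ^ n / (2 * (ℓ : ℝ) ^ 2))) := by
  set B := Real.exp (-(ρ ^ 2 * 2 ^ n / (2 * (ℓ : ℝ) ^ 2))) with hB
  let F : Fin ℓ → Fin ℓ → Finset (BV n) → ℝ := fun i j U =>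
    (if 2 ^ n * ρ / ℓ < ∑ y, dev κ S U y * (chiR y (S i) * chiR y (S j)) then wgt κ S U else 0)
    + (if 2 ^ n * ρ / ℓ < ∑ y, dev κ S U y * (-(chiR y (S i) * chiR y (S j)))
        then wgt κ S U else 0)
  have hF0 : ∀ i j U, 0 ≤ F i j U := by
    intro i j U
    have hw := wgt_nonneg hκ S U
    simp only [F]
    split_ifs <;> linarith
  have hF : ∀ i j, ∑ U, F i j U ≤ 2 * B := by
    intro i j
    simp only [F]
    rw [Finset.sum_add_distrib]
    have h1 := chernoff hℓ hκ hρ S (fun y => chiR y (S i) * chiR y (S j)) (by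
      intro y
      rcases chiR_pm y (S i) with h | h <;> rcases chiR_pm y (S j) with h' | h' <;> simp [h, h'])
    have h2 := chernoff hℓ hκ hρ S (fun y => -(chiR y (S i) * chiR y (S j))) (by
      intro y
      rcases chiR_pm y (S i) with h | h <;> rcases chiR_pm y (S j) with h' | h' <;> simp [h, h'])
    linarith
  calc _ ≤ ∑ U, ∑ i, ∑ j, F i j U := by
        refine Finset.sum_le_sum fun U _ => ?_
        by_cases h : ¬ Conc κ ρ S U
        · rw [if_pos h]
          simp only [Conc, not_forall, not_le] at h
          obtain ⟨i, j, hij⟩ := h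
          have hw := wgt_nonneg hκ S U
          have h1 : wgt κ S U ≤ F i j U := by
            simp only [F, mul_neg, Finset.sum_neg_distrib]
            rcases lt_abs.mp hij with h | h
            · rw [if_pos h]; split_ifs <;> linarith
            · rw [if_pos h]; split_ifs <;> linarith
          refine h1.trans ((Finset.single_le_sum (f := fun j => F i j U)
            (fun j _ => hF0 i j U) (Finset.mem_univ j)).trans ?_)
          exact Finset.single_le_sum (f := fun i => ∑ j, F i j U)
            (fun i _ => Finset.sum_nonneg fun j _ => hF0 i j U) (Finset.mem_univ i)
        · rw [if_neg h]
          exact Finset.sum_nonneg fun i _ => Finset.sum_nonneg fun j _ => hF0 i j U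
    _ = ∑ i, ∑ j, ∑ U, F i j U := by
        rw [Finset.sum_comm]
        refine Finset.sum_congr rfl fun i _ => ?_
        rw [Finset.sum_comm]
    _ ≤ ∑ i : Fin ℓ, ∑ j : Fin ℓ, 2 * B :=
        Finset.sum_le_sum fun i _ => Finset.sum_le_sum fun j _ => hF i j
    _ = _ := by simp; ring

lemma bad_one {n ℓ : ℕ} (j : Fin ℓ) (f : Fin 5 → Fin ℓ) (hf : ∀ a, f a ≠ j) :
    ((Finset.univ.filter fun S : Fin ℓ → BV n => S j = ∑ a, S (f a)).card : ℝ) * 2 ^ n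
      ≤ (2 ^ n) ^ ℓ := by
  have h : ((Finset.univ.filter fun S : Fin ℓ → BV n => S j = ∑ a, S (f a)) ×ˢ
      (Finset.univ : Finset (BV n))).card ≤ (Finset.univ : Finset (Fin ℓ → BV n)).card := by
    apply Finset.card_le_card_of_injOn (fun q => Function.update q.1 j q.2)
    · intro q _; simp
    · rintro ⟨S, z⟩ hq ⟨S', z'⟩ hq' h
      simp only [Finset.coe_product, Set.mem_prod, Finset.mem_coe, Finset.mem_filter,
        Finset.mem_univ, true_and, and_true] at hq hq'
      simp only at h
      have hoff : ∀ k, k ≠ j → S k = S' k := by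
        intro k hk
        have := congrFun h k
        simpa [Function.update_of_ne hk] using this
      have hz : z = z' := by simpa using congrFun h j
      have hS : S = S' := by
        funext k
        by_cases hk : k = j
        · subst hk
          rw [hq, hq']
          exact Finset.sum_congr rfl fun a _ => hoff _ (hf a)
        · exact hoff k hk
      rw [hz, hS]
  rw [Finset.card_product] at h
  have h2 : (((Finset.univ.filter fun S : Fin ℓ → BV n => S j = ∑ a, S (f a)).card
      * (Finset.univ : Finset (BV n)).card : ℕ) : ℝ)
      ≤ ((Finset.univ : Finset (Fin ℓ → BV n)).card : ℝ) := by exact_mod_cast h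
  push_cast at h2
  rw [Finset.card_univ, Finset.card_univ, card_BV] at h2
  refine h2.trans (le_of_eq ?_)
  rw [Fintype.card_fun, Nat.cast_pow, card_BV, Fintype.card_fin]

lemma bad_all (n ℓ : ℕ) :
    (∑ S : Fin ℓ → BV n, if ¬ GoodS S then (1:ℝ) else 0) ≤ ℓ ^ 6 / 2 ^ n * (2 ^ n) ^ ℓ := by
  have hN : (0:ℝ) < 2 ^ n := by positivity
  calc _ ≤ ∑ S : Fin ℓ → BV n, ∑ j : Fin ℓ, ∑ f : Fin 5 → Fin ℓ,
        (if (∀ a, f a ≠ j) ∧ S j = ∑ a, S (f a) then (1:ℝ) else 0) := by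
        refine Finset.sum_le_sum fun S _ => ?_
        have h0 : ∀ j : Fin ℓ, ∀ f : Fin 5 → Fin ℓ,
            (0:ℝ) ≤ (if (∀ a, f a ≠ j) ∧ S j = ∑ a, S (f a) then (1:ℝ) else 0) := by
          intro j f; split_ifs <;> norm_num
        by_cases h : ¬ GoodS S
        · rw [if_pos h]
          simp only [GoodS, not_forall, ne_eq, not_not] at h
          obtain ⟨j, f, hf, hj⟩ := h
          have h1 : (1:ℝ) ≤ (if (∀ a, f a ≠ j) ∧ S j = ∑ a, S (f a) then (1:ℝ) else 0) := by
            rw [if_pos ⟨hf, hj⟩]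
          refine h1.trans ((Finset.single_le_sum (f := fun f : Fin 5 → Fin ℓ =>
            (if (∀ a, f a ≠ j) ∧ S j = ∑ a, S (f a) then (1:ℝ) else 0))
            (fun f _ => h0 j f) (Finset.mem_univ f)).trans ?_)
          exact Finset.single_le_sum (f := fun j => ∑ f : Fin 5 → Fin ℓ,
            (if (∀ a, f a ≠ j) ∧ S j = ∑ a, S (f a) then (1:ℝ) else 0))
            (fun j _ => Finset.sum_nonneg fun f _ => h0 j f) (Finset.mem_univ j)
        · rw [if_neg h]
          exact Finset.sum_nonneg fun j _ => Finset.sum_nonneg fun f _ => h0 j f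
    _ = ∑ j : Fin ℓ, ∑ f : Fin 5 → Fin ℓ, ∑ S : Fin ℓ → BV n,
        (if (∀ a, f a ≠ j) ∧ S j = ∑ a, S (f a) then (1:ℝ) else 0) := by
        rw [Finset.sum_comm]
        refine Finset.sum_congr rfl fun j _ => ?_
        rw [Finset.sum_comm]
    _ ≤ ∑ j : Fin ℓ, ∑ f : Fin 5 → Fin ℓ, (2 ^ n) ^ ℓ / (2:ℝ) ^ n := by
        refine Finset.sum_le_sum fun j _ => Finset.sum_le_sum fun f _ => ?_
        by_cases hf : ∀ a, f a ≠ j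
        · rw [le_div_iff₀ hN]
          refine le_trans (le_of_eq ?_) (bad_one (n := n) j f hf)
          congr 1
          rw [Finset.card_eq_sum_ones, Finset.sum_filter]
          push_cast
          refine Finset.sum_congr rfl fun S _ => ?_
          simp [hf]
        · simp only [hf, false_and, if_false, Finset.sum_const_zero]
          positivity
    _ = _ := by simp; ring

/-- the `Strong` distribution is mostly supported on strong yes instances.
With `S` uniform on `({0,1}^n)^ℓ` and `U` sampled by independently including each `y` with
probability `1 − e^{−κγ_y^{(S)}}/2`, and `t1 = (1+κ)/2 + v/ℓ + ρ < t2 = (1+3κ)/2 − 15κ²/4 −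
5κ/ℓ − ρ`, the probability that `(S,U)` is not a `(t1,t2,v)`-strong yes instance is at most
`ℓ⁶2^{−n} + 2ℓ² exp(−ρ²2^n/(2ℓ²))`. -/
theorem strong_distribution_strong_yes (n ℓ : ℕ) (hℓ : 1 ≤ ℓ) (κ ρ : ℝ)
    (hκ0 : 0 ≤ κ) (hκ1 : κ ≤ 1) (hρ : 0 ≤ ρ) (v : ℕ)
    (ht : (1 + κ) / 2 + (v : ℝ) / (ℓ : ℝ) + ρ
        < (1 + 3 * κ) / 2 - 15 * κ ^ 2 / 4 - 5 * κ / (ℓ : ℝ) - ρ) :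
    (∑ S : Fin ℓ → BV n, ∑ U : Finset (BV n),
        if ¬ StrongYes ((1 + κ) / 2 + (v : ℝ) / (ℓ : ℝ) + ρ)
              ((1 + 3 * κ) / 2 - 15 * κ ^ 2 / 4 - 5 * κ / (ℓ : ℝ) - ρ) v S U
        then wgt κ S U else 0) / ((2 : ℝ) ^ n) ^ ℓ
      ≤ (ℓ : ℝ) ^ 6 / 2 ^ n + 2 * (ℓ : ℝ) ^ 2 * Real.exp (-(ρ ^ 2 * 2 ^ n / (2 * (ℓ : ℝ) ^ 2))) := by
  have hN : (0:ℝ) < 2 ^ n := by positivity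
  have hNl : (0:ℝ) < (2 ^ n) ^ ℓ := by positivity
  rw [div_le_iff₀ hNl]
  set B := 2 * (ℓ : ℝ) ^ 2 * Real.exp (-(ρ ^ 2 * 2 ^ n / (2 * (ℓ : ℝ) ^ 2))) with hB
  have hB0 : 0 ≤ B := by positivity
  have key : ∀ S : Fin ℓ → BV n, (∑ U : Finset (BV n),
        if ¬ StrongYes ((1 + κ) / 2 + (v : ℝ) / (ℓ : ℝ) + ρ)
              ((1 + 3 * κ) / 2 - 15 * κ ^ 2 / 4 - 5 * κ / (ℓ : ℝ) - ρ) v S U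
        then wgt κ S U else 0) ≤ (if ¬ GoodS S then (1:ℝ) else 0) + B := by
    intro S
    by_cases hS : GoodS S
    · rw [if_neg (not_not.mpr hS), zero_add]
      refine le_trans (Finset.sum_le_sum fun U _ => ?_) (conc_fail hℓ hκ0 hρ S)
      have hw := wgt_nonneg hκ0 S U
      by_cases hc : Conc κ ρ S U
      · rw [if_neg (not_not.mpr (good_conc_strong hℓ κ ρ hκ0 hκ1 hρ v hS hc)),
          if_neg (not_not.mpr hc)]
      · rw [if_pos hc]
        split_ifs <;> linarith
    · rw [if_pos hS, ← wgt_sum κ S]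
      refine le_add_of_le_of_nonneg (Finset.sum_le_sum fun U _ => ?_) hB0
      have hw := wgt_nonneg hκ0 S U
      split_ifs <;> linarith
  calc _ ≤ ∑ S : Fin ℓ → BV n, ((if ¬ GoodS S then (1:ℝ) else 0) + B) :=
        Finset.sum_le_sum fun S _ => key S
    _ = (∑ S : Fin ℓ → BV n, if ¬ GoodS S then (1:ℝ) else 0) + (2 ^ n) ^ ℓ * B := by
        rw [Finset.sum_add_distrib, Finset.sum_const, nsmul_eq_mul, Finset.card_univ,
          Fintype.card_fun, Nat.cast_pow, card_BV, Fintype.card_fin]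
    _ ≤ _ := by
        have := bad_all n ℓ
        linarith
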